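/- Let M be a finite-dimensional simple H_ℓ-module. Then the Y(gl_n)-module D_ℓ(M) is either zero or a simple Y(gl_n)-module. -/

import Mathlib

set_option synthInstance.maxHeartbeats 1000000
set_option maxHeartbeats 1000000

noncomputable section

open scoped TensorProduct

/-- Generators of the degenerate affine Hecke algebra `H_ℓ`:
the group elements `w ∈ W_ℓ` and the polynomial generators `ε_i`. -/
inductive HGen (ℓ : ℕ) : Type
  | perm : Equiv.Perm (Fin ℓ) → HGen ℓ
  | eps : Fin ℓ → HGen ℓ

/-- Defining relations of the degenerate affine Hecke algebra: `ℂ[W_ℓ]` is a subalgebra,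
`ℂ[ε_1,…,ε_ℓ]` is a (commutative polynomial) subalgebra, and the cross relation
`s_i ε_j − ε_{s_i(j)} s_i = −(δ_{i,j} − δ_{i+1,j})`. -/
inductive HRel (ℓ : ℕ) : FreeAlgebra ℂ (HGen ℓ) → FreeAlgebra ℂ (HGen ℓ) → Prop
  | permMul (w w' : Equiv.Perm (Fin ℓ)) :
      HRel ℓ (FreeAlgebra.ι ℂ (HGen.perm w) * FreeAlgebra.ι ℂ (HGen.perm w'))
        (FreeAlgebra.ι ℂ (HGen.perm (w * w')))
  | permOne :
      HRel ℓ (FreeAlgebra.ι ℂ (HGen.perm 1)) 1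
  | epsComm (i j : Fin ℓ) :
      HRel ℓ (FreeAlgebra.ι ℂ (HGen.eps i) * FreeAlgebra.ι ℂ (HGen.eps j))
        (FreeAlgebra.ι ℂ (HGen.eps j) * FreeAlgebra.ι ℂ (HGen.eps i))
  | cross (i j : Fin ℓ) (h : (i : ℕ) + 1 < ℓ) :
      HRel ℓ
        (FreeAlgebra.ι ℂ (HGen.perm (Equiv.swap i ⟨(i : ℕ) + 1, h⟩)) *
            FreeAlgebra.ι ℂ (HGen.eps j) -
          FreeAlgebra.ι ℂ (HGen.eps (Equiv.swap i ⟨(i : ℕ) + 1, h⟩ j)) *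
            FreeAlgebra.ι ℂ (HGen.perm (Equiv.swap i ⟨(i : ℕ) + 1, h⟩)))
        ((-(((if j = i then 1 else 0) : ℂ) - (if j = ⟨(i : ℕ) + 1, h⟩ then 1 else 0))) • 1)

/-- The degenerate affine Hecke algebra `H_ℓ`, as the algebra presented by the above
generators and relations. -/
abbrev Hecke (ℓ : ℕ) : Type := RingQuot (HRel ℓ)

/-- The image of `w ∈ W_ℓ` in `H_ℓ`. -/
def Hecke.sigma {ℓ : ℕ} (w : Equiv.Perm (Fin ℓ)) : Hecke ℓ :=
  RingQuot.mkAlgHom ℂ (HRel ℓ) (FreeAlgebra.ι ℂ (HGen.perm w))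

/-- The image of `ε_i` in `H_ℓ`. -/
def Hecke.eps {ℓ : ℕ} (i : Fin ℓ) : Hecke ℓ :=
  RingQuot.mkAlgHom ℂ (HRel ℓ) (FreeAlgebra.ι ℂ (HGen.eps i))

/-- The elements `y_m := ε_m − Σ_{j<m} s_{jm}` of `H_ℓ`. -/
def Hecke.y {ℓ : ℕ} (m : Fin ℓ) : Hecke ℓ :=
  Hecke.eps m - ∑ j ∈ Finset.univ.filter (fun j : Fin ℓ => j < m), Hecke.sigma (Equiv.swap j m)

/-- Index type for the Yangian generators `t_{ij}^{(d)}`. -/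
def tIdx (n : ℕ) : Type := Fin n × Fin n × ℕ

/-- `t_{ij}^{(d)}` in the free algebra, for `d : ℤ`, with the convention
`t_{ij}^{(-1)} = δ_{ij}·1` (and junk value `0` for `d ≤ -2`, which never occurs). -/
def tFree {n : ℕ} (i j : Fin n) (d : ℤ) : FreeAlgebra ℂ (tIdx n) :=
  if d = -1 then (if i = j then 1 else 0)
  else if 0 ≤ d then FreeAlgebra.ι ℂ ((i, j, d.toNat) : tIdx n) else 0

/-- Defining relations of the Yangian `Y(gl_n)`:
`[t_{ij}^{(r)}, t_{kl}^{(s−1)}] − [t_{ij}^{(r−1)}, t_{kl}^{(s)}]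
  = t_{kj}^{(r−1)} t_{il}^{(s−1)} − t_{kj}^{(s−1)} t_{il}^{(r−1)}`. -/
inductive YRel (n : ℕ) : FreeAlgebra ℂ (tIdx n) → FreeAlgebra ℂ (tIdx n) → Prop
  | rel (i j k l : Fin n) (r s : ℕ) :
      YRel n
        (tFree i j (r : ℤ) * tFree k l ((s : ℤ) - 1) - tFree k l ((s : ℤ) - 1) * tFree i j (r : ℤ)
          - (tFree i j ((r : ℤ) - 1) * tFree k l (s : ℤ)
              - tFree k l (s : ℤ) * tFree i j ((r : ℤ) - 1)))
        (tFree k j ((r : ℤ) - 1) * tFree i l ((s : ℤ) - 1) -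
          tFree k j ((s : ℤ) - 1) * tFree i l ((r : ℤ) - 1))

/-- The Yangian `Y(gl_n)`. -/
abbrev Yangian (n : ℕ) : Type := RingQuot (YRel n)

/-- The generator `t_{ij}^{(d)}`, `d ≥ 0`, of the Yangian. -/
def Yangian.t {n : ℕ} (i j : Fin n) (d : ℕ) : Yangian n :=
  RingQuot.mkAlgHom ℂ (YRel n) (FreeAlgebra.ι ℂ ((i, j, d) : tIdx n))

/-! ## The Drinfeld functor -/

/-- Words of length `ℓ` in the alphabet `{1,…,n}`: the standard basis of `(ℂ^n)^{⊗ℓ}`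
is indexed by such words. -/
abbrev Word (ℓ n : ℕ) : Type := Fin ℓ → Fin n

/-- Concrete model for `M ⊗ (ℂ^n)^{⊗ℓ}`: functions from words to `M`
(the value at a word is the coefficient of the corresponding basis vector). -/
abbrev MW (ℓ n : ℕ) (M : Type) : Type := Word ℓ n → M

section Dfun

variable {ℓ n : ℕ} {M : Type} [AddCommGroup M] [Module ℂ M]

/-- The operator `P_σ` permuting the tensor factors of `(ℂ^n)^{⊗ℓ}`. -/
def permOp (n : ℕ) {ℓ : ℕ} {M : Type} [AddCommGroup M] [Module ℂ M]
    (σ : Equiv.Perm (Fin ℓ)) : MW ℓ n M →ₗ[ℂ] MW ℓ n M where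
  toFun f := fun w => f (w ∘ σ)
  map_add' _ _ := rfl
  map_smul' _ _ := rfl

/-- The operator `τ_m(E_{ab})`, acting as the matrix unit `E_{ab}` on the `m`-th
tensor factor of `(ℂ^n)^{⊗ℓ}` and as the identity elsewhere. -/
def tauOp {ℓ n : ℕ} {M : Type} [AddCommGroup M] [Module ℂ M]
    (m : Fin ℓ) (a b : Fin n) : MW ℓ n M →ₗ[ℂ] MW ℓ n M where
  toFun f := fun w => if w m = a then f (Function.update w m b) else 0
  map_add' f g := by funext w; by_cases h : w m = a <;> simp [h]
  map_smul' c f := by funext w; by_cases h : w m = a <;> simp [h]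

/-- The action of `h ∈ H_ℓ` on the coefficients (i.e. on the factor `M`). -/
def hOp (n : ℕ) {ℓ : ℕ} {M : Type} [AddCommGroup M] [Module ℂ M]
    (ρ : Hecke ℓ →ₐ[ℂ] Module.End ℂ M) (h : Hecke ℓ) : MW ℓ n M →ₗ[ℂ] MW ℓ n M :=
  (ρ h).compLeft (Word ℓ n)

/-- The action of the transposition `s_{ij} ∈ W_ℓ` on `M ⊗ (ℂ^n)^{⊗ℓ}`, namely
`K_{ij} P_{ij}`. -/
def sOp (n : ℕ) {ℓ : ℕ} {M : Type} [AddCommGroup M] [Module ℂ M]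
    (ρ : Hecke ℓ →ₐ[ℂ] Module.End ℂ M) (i j : Fin ℓ) : MW ℓ n M →ₗ[ℂ] MW ℓ n M :=
  hOp n ρ (Hecke.sigma (Equiv.swap i j)) ∘ₗ permOp n (Equiv.swap i j)

/-- The subspace `N(M) = Σ_{i=1}^{ℓ-1} Im(s_i + 1)` of `M ⊗ (ℂ^n)^{⊗ℓ}`. -/
def NSub (n : ℕ) {ℓ : ℕ} {M : Type} [AddCommGroup M] [Module ℂ M]
    (ρ : Hecke ℓ →ₐ[ℂ] Module.End ℂ M) : Submodule ℂ (MW ℓ n M) :=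
  ⨆ (i : Fin ℓ) (h : (i : ℕ) + 1 < ℓ),
    LinearMap.range (sOp n ρ i ⟨(i : ℕ) + 1, h⟩ + LinearMap.id)

/-- The Drinfeld functor: `D_ℓ(M) = (M ⊗ (ℂ^n)^{⊗ℓ})/N(M)`. -/
abbrev Dmod (n : ℕ) {ℓ : ℕ} {M : Type} [AddCommGroup M] [Module ℂ M]
    (ρ : Hecke ℓ →ₐ[ℂ] Module.End ℂ M) : Type :=
  MW ℓ n M ⧸ NSub n ρ

/-- The operator `Σ_{m=1}^{ℓ} y_m^d ⊗ τ_m(E_{ab})` on `M ⊗ (ℂ^n)^{⊗ℓ}`. -/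
def sumOp (n : ℕ) {ℓ : ℕ} {M : Type} [AddCommGroup M] [Module ℂ M]
    (ρ : Hecke ℓ →ₐ[ℂ] Module.End ℂ M) (a b : Fin n) (d : ℕ) :
    MW ℓ n M →ₗ[ℂ] MW ℓ n M :=
  ∑ m : Fin ℓ, hOp n ρ ((Hecke.y m) ^ d) ∘ₗ tauOp m a b

/-- `π` is the Yangian action on `D_ℓ(M)` provided by Propositions 2.1 and 2.4 of
the paper: `t_{ab}^{(d)}` acts by the endomorphism induced by
`Σ_{m=1}^{ℓ} y_m^d ⊗ τ_m(E_{ab})`. -/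
def IsDrinfeldAction (n : ℕ) {ℓ : ℕ} {M : Type} [AddCommGroup M] [Module ℂ M]
    (ρ : Hecke ℓ →ₐ[ℂ] Module.End ℂ M)
    (π : Yangian n →ₐ[ℂ] Module.End ℂ (Dmod n ρ)) : Prop :=
  ∀ (a b : Fin n) (d : ℕ) (f : MW ℓ n M),
    π (Yangian.t a b d) (Submodule.Quotient.mk f) = Submodule.Quotient.mk (sumOp n ρ a b d f)

/-- A subspace stable under a Yangian action: a `Y(gl_n)`-submodule. -/
def YStable {n : ℕ} {V : Type} [AddCommGroup V] [Module ℂ V]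
    (π : Yangian n →ₐ[ℂ] Module.End ℂ V) (q : Submodule ℂ V) : Prop :=
  ∀ (y : Yangian n) (x : V), x ∈ q → π y x ∈ q

/-- A nonzero `Y(gl_n)`-module with no proper nonzero submodule: a simple module. -/
def YSimple {n : ℕ} {V : Type} [AddCommGroup V] [Module ℂ V]
    (π : Yangian n →ₐ[ℂ] Module.End ℂ V) : Prop :=
  Nontrivial V ∧ ∀ q : Submodule ℂ V, YStable π q → q = ⊥ ∨ q = ⊤

/-- A subspace stable under an `H_ℓ`-action: an `H_ℓ`-submodule. -/
def HStable {ℓ : ℕ} {M : Type} [AddCommGroup M] [Module ℂ M]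
    (ρ : Hecke ℓ →ₐ[ℂ] Module.End ℂ M) (p : Submodule ℂ M) : Prop :=
  ∀ (h : Hecke ℓ) (x : M), x ∈ p → ρ h x ∈ p

/-- A nonzero `H_ℓ`-module with no proper nonzero submodule: a simple module. -/
def HSimple {ℓ : ℕ} {M : Type} [AddCommGroup M] [Module ℂ M]
    (ρ : Hecke ℓ →ₐ[ℂ] Module.End ℂ M) : Prop :=
  Nontrivial M ∧ ∀ p : Submodule ℂ M, HStable ρ p → p = ⊥ ∨ p = ⊤

end Dfun

namespace Hecke

variable {ℓ : ℕ}

lemma sigma_mul (v w : Equiv.Perm (Fin ℓ)) : sigma (v * w) = sigma v * sigma w := by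
  simpa [sigma] using (RingQuot.mkAlgHom_rel ℂ (HRel.permMul v w)).symm

lemma sigma_one : sigma (1 : Equiv.Perm (Fin ℓ)) = 1 := by
  simpa [sigma] using RingQuot.mkAlgHom_rel ℂ (HRel.permOne (ℓ := ℓ))

lemma eps_comm (i j : Fin ℓ) : eps i * eps j = eps j * eps i := by
  simpa [eps] using RingQuot.mkAlgHom_rel ℂ (HRel.epsComm i j)

lemma sigma_swap_mul_eps (i j : Fin ℓ) (h : (i : ℕ) + 1 < ℓ) :
    sigma (Equiv.swap i ⟨i + 1, h⟩) * eps j =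
      eps (Equiv.swap i ⟨i + 1, h⟩ j) * sigma (Equiv.swap i ⟨i + 1, h⟩) +
        (-(((if j = i then 1 else 0) : ℂ) - (if j = ⟨(i : ℕ) + 1, h⟩ then 1 else 0))) • 1 := by
  rw [← sub_eq_iff_eq_add']
  simpa only [sigma, eps, map_sub, map_mul, map_smul, map_one] using
    RingQuot.mkAlgHom_rel ℂ (HRel.cross i j h)

/-- The Jucys–Murphy element `Σ_{j<m} s_{jm}`. -/
def jucysMurphy (m : Fin ℓ) : Hecke ℓ := ∑ j, if j < m then sigma (Equiv.swap j m) else 0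

lemma y_eq_eps_sub (m : Fin ℓ) : y m = eps m - jucysMurphy m := by
  rw [y, jucysMurphy, Finset.sum_filter]

lemma sigma_swap_mul_jucysMurphy (i m : Fin ℓ) (h : (i : ℕ) + 1 < ℓ) :
    sigma (Equiv.swap i ⟨i + 1, h⟩) * jucysMurphy m =
      jucysMurphy (Equiv.swap i ⟨i + 1, h⟩ m) * sigma (Equiv.swap i ⟨i + 1, h⟩) +
        (-(((if m = i then 1 else 0) : ℂ) - (if m = ⟨(i : ℕ) + 1, h⟩ then 1 else 0))) • 1 := by
  set k : Fin ℓ := ⟨i + 1, h⟩ with hk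
  have hki : k ≠ i := by simp [hk, Fin.ext_iff]
  have hss : sigma (Equiv.swap i k) * sigma (Equiv.swap i k) = 1 := by
    rw [← sigma_mul, Equiv.swap_mul_self, sigma_one]
  have hkey : ∀ j, (if Equiv.swap i k j < m then
        sigma (Equiv.swap j (Equiv.swap i k m)) * sigma (Equiv.swap i k) else 0) =
      (if j < Equiv.swap i k m then
        sigma (Equiv.swap j (Equiv.swap i k m)) * sigma (Equiv.swap i k) else 0) +
      (if j = i then (if m = i then -1 else 0) else 0) +
      (if j = k then (if m = k then 1 else 0) else 0) := by
    intro j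
    rcases eq_or_ne m i with rfl | hmi
    · rcases eq_or_ne j m with rfl | hjm
      · have : ¬ k < j := by simp [hk, Fin.lt_def]
        have h2 : j < k := by simp [hk, Fin.lt_def]
        simp [this, h2, hki.symm, hss]
      · rcases eq_or_ne j k with rfl | hjk
        · simp [hki, hki.symm]
        · have : (j < m) ↔ j < k := by
            simp only [hk, Fin.lt_def, Fin.ext_iff, ne_eq] at *; omega
          simp [hjm, hjk, Equiv.swap_apply_of_ne_of_ne, this]
    · rcases eq_or_ne m k with rfl | hmk
      · rcases eq_or_ne j i with rfl | hji
        · simp [hki, hki.symm]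
        · rcases eq_or_ne j k with rfl | hjk
          · have h2 : i < k := by simp [hk, Fin.lt_def]
            have h3 : ¬ k < i := by simp [hk, Fin.lt_def]
            rw [Equiv.swap_apply_right, Equiv.swap_comm k i]
            simp [hki, h2, h3, hss]
          · have : (j < k) ↔ j < i := by
              simp only [hk, Fin.lt_def, Fin.ext_iff, ne_eq] at *; omega
            simp [hji, hjk, Equiv.swap_apply_of_ne_of_ne, this]
      · have hm : Equiv.swap i k m = m := Equiv.swap_apply_of_ne_of_ne hmi hmk
        have : (Equiv.swap i k j < m) ↔ j < m := by
          rcases eq_or_ne j i with rfl | hji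
          · rw [Equiv.swap_apply_left]
            simp only [hk, Fin.lt_def, Fin.ext_iff, ne_eq] at *; omega
          · rcases eq_or_ne j k with rfl | hjk
            · rw [Equiv.swap_apply_right]
              simp only [hk, Fin.lt_def, Fin.ext_iff, ne_eq] at *; omega
            · rw [Equiv.swap_apply_of_ne_of_ne hji hjk]
        simp [hm, hmi, hmk, this]
  have hconj : ∀ j, sigma (Equiv.swap i k) * sigma (Equiv.swap j m) =
      sigma (Equiv.swap (Equiv.swap i k j) (Equiv.swap i k m)) * sigma (Equiv.swap i k) := by
    intro j
    rw [← sigma_mul, ← sigma_mul, Equiv.mul_swap_eq_swap_mul]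
  have hre : sigma (Equiv.swap i k) * jucysMurphy m = ∑ j, if Equiv.swap i k j < m then
        sigma (Equiv.swap j (Equiv.swap i k m)) * sigma (Equiv.swap i k) else 0 := by
    rw [jucysMurphy, Finset.mul_sum, ← Equiv.sum_comp (Equiv.swap i k)]
    refine Finset.sum_congr rfl fun j _ => ?_
    rw [mul_ite, mul_zero, hconj, Equiv.swap_apply_self]
  rw [hre, Finset.sum_congr rfl fun j _ => hkey j, Finset.sum_add_distrib,
    Finset.sum_add_distrib, jucysMurphy, Finset.sum_mul, add_assoc]
  congr 1
  · simp only [ite_mul, zero_mul]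
  · rw [Finset.sum_ite_eq' Finset.univ i, Finset.sum_ite_eq' Finset.univ k,
      if_pos (Finset.mem_univ _), if_pos (Finset.mem_univ _)]
    rcases eq_or_ne m i with rfl | hmi
    · simp only [if_true, if_neg hki.symm, add_zero, sub_zero]
      exact (neg_one_smul ℂ (1 : Hecke ℓ)).symm
    · rcases eq_or_ne m k with hmk | hmk
      · simp only [if_neg hmi, if_pos hmk, zero_add, zero_sub, neg_neg]
        exact (one_smul ℂ (1 : Hecke ℓ)).symm
      · simp only [if_neg hmi, if_neg hmk, add_zero, sub_zero, neg_zero]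
        exact (zero_smul ℂ (1 : Hecke ℓ)).symm

lemma sigma_swap_mul_y (i m : Fin ℓ) (h : (i : ℕ) + 1 < ℓ) :
    sigma (Equiv.swap i ⟨i + 1, h⟩) * y m =
      y (Equiv.swap i ⟨i + 1, h⟩ m) * sigma (Equiv.swap i ⟨i + 1, h⟩) := by
  rw [y_eq_eps_sub, y_eq_eps_sub, mul_sub, sub_mul, sigma_swap_mul_eps,
    sigma_swap_mul_jucysMurphy]
  abel

end Hecke

/-- Induction on permutations of `Fin ℓ` along the generating set of simple transpositions. -/
lemma Equiv.Perm.simple_transposition_induction {ℓ : ℕ} {P : Equiv.Perm (Fin ℓ) → Prop}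
    (one : P 1)
    (swap_mul : ∀ (i : Fin ℓ) (h : (i : ℕ) + 1 < ℓ) (w : Equiv.Perm (Fin ℓ)), P w →
      P (Equiv.swap i ⟨i + 1, h⟩ * w)) (w : Equiv.Perm (Fin ℓ)) : P w := by
  cases ℓ with
  | zero => rwa [Subsingleton.elim w 1]
  | succ k =>
    have hw : w ∈ Submonoid.closure
        (Set.range fun i : Fin k => Equiv.swap i.castSucc i.succ) := by
      rw [Equiv.Perm.mclosure_swap_castSucc_succ]; trivial
    induction hw using Submonoid.closure_induction_left with
    | one => exact one
    | mul_left x hx y _ ih =>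
      obtain ⟨i, rfl⟩ := hx
      exact swap_mul i.castSucc (by simp) y ih

namespace Hecke

variable {ℓ : ℕ}

lemma sigma_mul_y (w : Equiv.Perm (Fin ℓ)) (m : Fin ℓ) :
    sigma w * y m = y (w m) * sigma w := by
  induction w using Equiv.Perm.simple_transposition_induction generalizing m with
  | one => simp [sigma_one]
  | swap_mul i h w ih =>
    rw [sigma_mul, mul_assoc, ih, ← mul_assoc, sigma_swap_mul_y, mul_assoc, Equiv.Perm.mul_apply]

/-- The product `y_{m_1} ⋯ y_{m_r}` attached to a list `[m_1, …, m_r]`. -/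
def yProd (l : List (Fin ℓ)) : Hecke ℓ := (l.map y).prod

lemma yProd_nil : yProd ([] : List (Fin ℓ)) = 1 := rfl

lemma yProd_cons (m : Fin ℓ) (l : List (Fin ℓ)) : yProd (m :: l) = y m * yProd l := by
  simp [yProd]

lemma yProd_replicate_append (d : ℕ) (m : Fin ℓ) (l : List (Fin ℓ)) :
    yProd (List.replicate d m ++ l) = y m ^ d * yProd l := by
  simp [yProd]

lemma sigma_mul_yProd (w : Equiv.Perm (Fin ℓ)) (l : List (Fin ℓ)) :
    sigma w * yProd l = yProd (l.map w) * sigma w := by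
  induction l with
  | nil => simp [yProd_nil]
  | cons m l ih =>
    rw [List.map_cons, yProd_cons, yProd_cons, ← mul_assoc, sigma_mul_y, mul_assoc, ih, mul_assoc]

/-- The span of the elements `y_{m_1} ⋯ y_{m_r} w` with `r < N` and `w ∈ W_ℓ`. -/
def filtration (ℓ N : ℕ) : Submodule ℂ (Hecke ℓ) :=
  Submodule.span ℂ {h | ∃ (l : List (Fin ℓ)) (w : Equiv.Perm (Fin ℓ)),
    l.length < N ∧ h = yProd l * sigma w}

lemma yProd_mul_sigma_mem_filtration {N : ℕ} {l : List (Fin ℓ)} (w : Equiv.Perm (Fin ℓ))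
    (hl : l.length < N) : yProd l * sigma w ∈ filtration ℓ N :=
  Submodule.subset_span ⟨l, w, hl, rfl⟩

lemma filtration_mono {N N' : ℕ} (h : N ≤ N') : filtration ℓ N ≤ filtration ℓ N' := by
  refine Submodule.span_mono ?_
  rintro _ ⟨l, w, hl, rfl⟩
  exact ⟨l, w, hl.trans_le h, rfl⟩

lemma y_mul_mem_filtration {N : ℕ} (m : Fin ℓ) {x : Hecke ℓ} (hx : x ∈ filtration ℓ N) :
    y m * x ∈ filtration ℓ (N + 1) := by
  refine Submodule.span_induction ?_ ?_ ?_ ?_ hx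
  · rintro _ ⟨l, w, hl, rfl⟩
    rw [← mul_assoc, ← yProd_cons]
    exact yProd_mul_sigma_mem_filtration w (by simpa using hl)
  · simp
  · intro a b _ _ ha hb
    rw [mul_add]
    exact add_mem ha hb
  · intro c a _ ha
    rw [mul_smul_comm]
    exact Submodule.smul_mem _ _ ha

lemma sigma_mul_mem_filtration {N : ℕ} (v : Equiv.Perm (Fin ℓ)) {x : Hecke ℓ}
    (hx : x ∈ filtration ℓ N) : sigma v * x ∈ filtration ℓ N := by
  refine Submodule.span_induction ?_ ?_ ?_ ?_ hx
  · rintro _ ⟨l, w, hl, rfl⟩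
    rw [← mul_assoc, sigma_mul_yProd, mul_assoc, ← sigma_mul]
    exact yProd_mul_sigma_mem_filtration _ (by simpa using hl)
  · simp
  · intro a b _ _ ha hb
    rw [mul_add]
    exact add_mem ha hb
  · intro c a _ ha
    rw [mul_smul_comm]
    exact Submodule.smul_mem _ _ ha

lemma jucysMurphy_mul_mem_filtration {N : ℕ} (m : Fin ℓ) {x : Hecke ℓ}
    (hx : x ∈ filtration ℓ N) : jucysMurphy m * x ∈ filtration ℓ N := by
  rw [jucysMurphy, Finset.sum_mul]
  refine sum_mem fun j _ => ?_
  split_ifs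
  · exact sigma_mul_mem_filtration _ hx
  · simp

lemma mul_jucysMurphy_mem_filtration {N : ℕ} (m : Fin ℓ) {x : Hecke ℓ}
    (hx : x ∈ filtration ℓ N) : x * jucysMurphy m ∈ filtration ℓ N := by
  rw [jucysMurphy, Finset.mul_sum]
  refine sum_mem fun j _ => ?_
  split_ifs
  · refine Submodule.span_induction ?_ ?_ ?_ ?_ hx
    · rintro _ ⟨l, w, hl, rfl⟩
      rw [mul_assoc, ← sigma_mul]
      exact yProd_mul_sigma_mem_filtration _ hl
    · simp
    · intro a b _ _ ha hb
      rw [add_mul]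
      exact add_mem ha hb
    · intro c a _ ha
      rw [smul_mul_assoc]
      exact Submodule.smul_mem _ _ ha
  · simp

lemma eps_mul_mem_filtration {N : ℕ} (m : Fin ℓ) {x : Hecke ℓ} (hx : x ∈ filtration ℓ N) :
    eps m * x ∈ filtration ℓ (N + 1) := by
  rw [eq_add_of_sub_eq (y_eq_eps_sub m).symm, add_mul]
  exact add_mem (y_mul_mem_filtration m hx)
    (filtration_mono N.le_succ (jucysMurphy_mul_mem_filtration m hx))

lemma one_mem_filtration : (1 : Hecke ℓ) ∈ filtration ℓ 1 := by
  simpa [yProd_nil, sigma_one] using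
    yProd_mul_sigma_mem_filtration (N := 1) (l := []) (1 : Equiv.Perm (Fin ℓ)) (by simp)

lemma commutator_y_mem_filtration (i j : Fin ℓ) : y i * y j - y j * y i ∈ filtration ℓ 2 := by
  have hy (m : Fin ℓ) : y m ∈ filtration ℓ 2 := by
    simpa using y_mul_mem_filtration m one_mem_filtration
  have hJ (m : Fin ℓ) : jucysMurphy m ∈ filtration ℓ 2 := by
    simpa using filtration_mono one_le_two (jucysMurphy_mul_mem_filtration m one_mem_filtration)
  have h : y i * y j - y j * y i = y j * jucysMurphy i - y i * jucysMurphy j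
      + jucysMurphy j * y i - jucysMurphy i * y j
      + (jucysMurphy j * jucysMurphy i - jucysMurphy i * jucysMurphy j) := by
    have h1 := eq_add_of_sub_eq (y_eq_eps_sub i).symm
    have h2 := eq_add_of_sub_eq (y_eq_eps_sub j).symm
    have h3 := eps_comm i j
    rw [h1, h2] at h3
    have h4 : y i * y j - y j * y i - (y j * jucysMurphy i - y i * jucysMurphy j
      + jucysMurphy j * y i - jucysMurphy i * y j
      + (jucysMurphy j * jucysMurphy i - jucysMurphy i * jucysMurphy j)) =
      (y i + jucysMurphy i) * (y j + jucysMurphy j) -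
        (y j + jucysMurphy j) * (y i + jucysMurphy i) := by
      noncomm_ring
    rw [← sub_eq_zero, h4, h3, sub_self]
  rw [h]
  exact add_mem (sub_mem (add_mem (sub_mem (mul_jucysMurphy_mem_filtration _ (hy _))
    (mul_jucysMurphy_mem_filtration _ (hy _))) (jucysMurphy_mul_mem_filtration _ (hy _)))
    (jucysMurphy_mul_mem_filtration _ (hy _))) (sub_mem (jucysMurphy_mul_mem_filtration _ (hJ _))
    (jucysMurphy_mul_mem_filtration _ (hJ _)))

lemma mul_yProd_mem_filtration {N : ℕ} {x : Hecke ℓ} (hx : x ∈ filtration ℓ N)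
    (l : List (Fin ℓ)) : x * yProd l ∈ filtration ℓ (N + l.length) := by
  refine Submodule.span_induction ?_ ?_ ?_ ?_ hx
  · rintro _ ⟨l', w, hl, rfl⟩
    have h : yProd l' * yProd (l.map w) = yProd (l' ++ l.map w) := by simp [yProd]
    rw [mul_assoc, sigma_mul_yProd, ← mul_assoc, h]
    exact yProd_mul_sigma_mem_filtration w (by simpa using hl)
  · simp
  · intro a b _ _ ha hb
    rw [add_mul]
    exact add_mem ha hb
  · intro c a _ ha
    rw [smul_mul_assoc]
    exact Submodule.smul_mem _ _ ha

/-- Reordering a product of `y`'s changes it only by terms of lower degree. -/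
lemma yProd_sub_yProd_mem_filtration {l l' : List (Fin ℓ)} (h : l.Perm l') :
    yProd l - yProd l' ∈ filtration ℓ l.length := by
  induction h with
  | nil => simp
  | cons m _ ih =>
    rw [yProd_cons, yProd_cons, ← mul_sub]
    exact y_mul_mem_filtration m ih
  | swap i j l =>
    simp only [yProd_cons, ← mul_assoc]
    rw [← sub_mul]
    have := mul_yProd_mem_filtration (commutator_y_mem_filtration j i) l
    rwa [add_comm] at this
  | trans h₁ _ ih₁ ih₂ =>
    rw [← sub_add_sub_cancel]
    exact add_mem ih₁ (h₁.length_eq ▸ ih₂)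

lemma exists_mem_filtration (h : Hecke ℓ) : ∃ N, h ∈ filtration ℓ N := by
  suffices H : ∀ (a : FreeAlgebra ℂ (HGen ℓ)) (N : ℕ) (x : Hecke ℓ), x ∈ filtration ℓ N →
      ∃ N', RingQuot.mkAlgHom ℂ (HRel ℓ) a * x ∈ filtration ℓ N' by
    obtain ⟨a, rfl⟩ := RingQuot.mkAlgHom_surjective ℂ (HRel ℓ) h
    simpa using H a 1 1 one_mem_filtration
  intro a
  induction a using FreeAlgebra.induction with
  | grade0 r =>
    intro N x hx
    refine ⟨N, ?_⟩
    rw [AlgHom.commutes, ← Algebra.smul_def]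
    exact Submodule.smul_mem _ _ hx
  | grade1 g =>
    intro N x hx
    cases g with
    | perm w => exact ⟨N, sigma_mul_mem_filtration w hx⟩
    | eps i => exact ⟨N + 1, eps_mul_mem_filtration i hx⟩
  | mul a b iha ihb =>
    intro N x hx
    obtain ⟨N₁, h₁⟩ := ihb N x hx
    obtain ⟨N₂, h₂⟩ := iha N₁ _ h₁
    exact ⟨N₂, by rwa [map_mul, mul_assoc]⟩
  | add a b iha ihb =>
    intro N x hx
    obtain ⟨N₁, h₁⟩ := iha N x hx
    obtain ⟨N₂, h₂⟩ := ihb N x hx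
    refine ⟨max N₁ N₂, ?_⟩
    rw [map_add, add_mul]
    exact add_mem (filtration_mono (le_max_left _ _) h₁) (filtration_mono (le_max_right _ _) h₂)

end Hecke

section DrinfeldModule

variable {ℓ n : ℕ} {M : Type} [AddCommGroup M] [Module ℂ M]

/-- The matrix unit sending the letters `v m` to `u m` in the tensor slots `m ∈ I`, and acting as
the identity in the other slots. -/
def unitOp (I : Finset (Fin ℓ)) (u v : Word ℓ n) : Module.End ℂ (MW ℓ n M) where
  toFun f := fun w => if ∀ m ∈ I, w m = u m then f (I.piecewise v w) else 0
  map_add' f g := by funext w; simp only [Pi.add_apply]; split_ifs <;> simp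
  map_smul' c f := by funext w; simp only [Pi.smul_apply]; split_ifs <;> simp

lemma unitOp_apply (I : Finset (Fin ℓ)) (u v : Word ℓ n) (f : MW ℓ n M) (w : Word ℓ n) :
    unitOp I u v f w = if ∀ m ∈ I, w m = u m then f (I.piecewise v w) else 0 := rfl

lemma unitOp_empty (u v : Word ℓ n) : unitOp (M := M) ∅ u v = 1 := by
  ext f w
  simp [unitOp_apply]

lemma unitOp_univ_apply (u v : Word ℓ n) (f : MW ℓ n M) (w : Word ℓ n) :
    unitOp Finset.univ u v f w = if w = u then f v else 0 := by
  simp [unitOp_apply, funext_iff]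

lemma tauOp_apply (m : Fin ℓ) (a b : Fin n) (f : MW ℓ n M) (w : Word ℓ n) :
    tauOp m a b f w = if w m = a then f (Function.update w m b) else 0 := rfl

lemma tauOp_mul_unitOp_of_notMem {I : Finset (Fin ℓ)} {m : Fin ℓ} (hm : m ∉ I)
    (u v : Word ℓ n) :
    tauOp m (u m) (v m) * unitOp I u v = unitOp (M := M) (insert m I) u v := by
  refine LinearMap.ext fun f => funext fun w => ?_
  rw [Module.End.mul_apply, tauOp_apply, unitOp_apply, unitOp_apply]
  have h1 : (∀ k ∈ I, Function.update w m (v m) k = u k) ↔ ∀ k ∈ I, w k = u k :=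
    forall₂_congr fun k hk => by
      rw [Function.update_of_ne (ne_of_mem_of_not_mem hk hm)]
  have h2 : I.piecewise v (Function.update w m (v m)) = (insert m I).piecewise v w := by
    rw [Finset.piecewise_insert, Finset.update_piecewise_of_notMem _ _ _ hm]
  simp only [h1, h2, Finset.forall_mem_insert, ite_and]

lemma tauOp_mul_unitOp_of_mem {I : Finset (Fin ℓ)} {m : Fin ℓ} (hm : m ∈ I)
    (a b : Fin n) (u v : Word ℓ n) :
    tauOp m a b * unitOp (M := M) I u v =
      if b = u m then unitOp I (Function.update u m a) v else 0 := by
  refine LinearMap.ext fun f => funext fun w => ?_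
  have h2 : I.piecewise v (Function.update w m b) = I.piecewise v w := by
    ext k
    by_cases hk : k ∈ I
    · simp [hk]
    · simp [hk, (ne_of_mem_of_not_mem hm hk).symm]
  have h1 : (w m = a ∧ ∀ k ∈ I, Function.update w m b k = u k) ↔
      b = u m ∧ ∀ k ∈ I, w k = Function.update u m a k := by
    constructor
    · rintro ⟨h, h'⟩
      refine ⟨by simpa using h' m hm, fun k hk => ?_⟩
      rcases eq_or_ne k m with rfl | hkm
      · simpa using h
      · simpa [hkm] using h' k hk
    · rintro ⟨h, h'⟩
      refine ⟨by simpa using h' m hm, fun k hk => ?_⟩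
      rcases eq_or_ne k m with rfl | hkm
      · simpa using h
      · simpa [hkm] using h' k hk
  rw [Module.End.mul_apply, tauOp_apply, unitOp_apply, h2, ← ite_and, if_congr h1 rfl rfl, ite_and]
  split_ifs with _ hw
  · rw [unitOp_apply, if_pos hw]
  · rw [unitOp_apply, if_neg hw]
  · rfl

/-- The operators on `M ⊗ (ℂ^n)^{⊗ℓ}` coming from endomorphisms of `(ℂ^n)^{⊗ℓ}`. -/
def matrixOps (ℓ n : ℕ) (M : Type) [AddCommGroup M] [Module ℂ M] :
    Submodule ℂ (Module.End ℂ (MW ℓ n M)) :=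
  Submodule.span ℂ (Set.range fun p : Word ℓ n × Word ℓ n => unitOp Finset.univ p.1 p.2)

lemma unitOp_univ_mem_matrixOps (u v : Word ℓ n) :
    unitOp Finset.univ u v ∈ matrixOps ℓ n M :=
  Submodule.subset_span ⟨(u, v), rfl⟩

lemma unitOp_mem_matrixOps (I : Finset (Fin ℓ)) (u v : Word ℓ n) :
    unitOp I u v ∈ matrixOps ℓ n M := by
  have h : unitOp (M := M) I u v =
      ∑ z : Word ℓ n with ∀ m ∈ I, z m = u m, unitOp Finset.univ z (I.piecewise v z) := by
    refine LinearMap.ext fun f => funext fun w => ?_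
    rw [LinearMap.sum_apply, Finset.sum_apply, unitOp_apply]
    simp only [unitOp_univ_apply, Finset.sum_ite_eq, Finset.mem_filter, Finset.mem_univ, true_and]
  rw [h]
  exact sum_mem fun z _ => unitOp_univ_mem_matrixOps _ _

lemma permOp_apply (σ : Equiv.Perm (Fin ℓ)) (f : MW ℓ n M) (w : Word ℓ n) :
    permOp n σ f w = f (w ∘ σ) := rfl

lemma mul_permOp_mem_matrixOps (σ : Equiv.Perm (Fin ℓ)) {X : Module.End ℂ (MW ℓ n M)}
    (hX : X ∈ matrixOps ℓ n M) : X * permOp n σ ∈ matrixOps ℓ n M := by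
  refine Submodule.span_induction ?_ ?_ ?_ ?_ hX
  · rintro _ ⟨⟨u, v⟩, rfl⟩
    have h : unitOp (M := M) Finset.univ u v * permOp n σ =
        unitOp Finset.univ u (v ∘ σ) := by
      refine LinearMap.ext fun f => funext fun w => ?_
      rw [Module.End.mul_apply, unitOp_univ_apply, unitOp_univ_apply, permOp_apply]
    rw [h]
    exact unitOp_univ_mem_matrixOps _ _
  · simp
  · intro a b _ _ ha hb
    rw [add_mul]
    exact add_mem ha hb
  · intro c a _ ha
    rw [smul_mul_assoc]
    exact Submodule.smul_mem _ _ ha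

lemma permOp_mul_permOp (σ τ : Equiv.Perm (Fin ℓ)) :
    permOp n σ * permOp (M := M) n τ = permOp n (σ * τ) := rfl

lemma permOp_one : permOp (M := M) n (1 : Equiv.Perm (Fin ℓ)) = 1 := rfl

lemma permOp_mul_tauOp (σ : Equiv.Perm (Fin ℓ)) (m : Fin ℓ) (a b : Fin n) :
    permOp n σ * tauOp (M := M) m a b = tauOp (σ m) a b * permOp n σ := by
  refine LinearMap.ext fun f => funext fun w => ?_
  simp only [Module.End.mul_apply, permOp_apply, tauOp_apply, Function.comp_apply,
    Function.update_comp_equiv, Equiv.symm_apply_apply]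

lemma permOp_mul_unitOp {σ : Equiv.Perm (Fin ℓ)} {I : Finset (Fin ℓ)} (hσ : ∀ m ∈ I, σ m = m)
    (u v : Word ℓ n) :
    permOp n σ * unitOp (M := M) I u v = unitOp I u v * permOp n σ := by
  refine LinearMap.ext fun f => funext fun w => ?_
  simp only [Module.End.mul_apply, permOp_apply, unitOp_apply]
  have h1 : (∀ m ∈ I, (w ∘ σ) m = u m) ↔ ∀ m ∈ I, w m = u m :=
    forall₂_congr fun k hk => by rw [Function.comp_apply, hσ k hk]
  have h2 : I.piecewise v (w ∘ σ) = I.piecewise v w ∘ σ := by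
    ext k
    by_cases hk : k ∈ I
    · simp [hk, hσ k hk]
    · have : σ k ∉ I := fun h => hk (by rwa [σ.injective (hσ _ h)] at h)
      simp [hk, this]
  rw [if_congr h1 rfl rfl, h2]

variable (ρ : Hecke ℓ →ₐ[ℂ] Module.End ℂ M)

lemma hOp_apply (h : Hecke ℓ) (f : MW ℓ n M) (w : Word ℓ n) : hOp n ρ h f w = ρ h (f w) := rfl

lemma hOp_mul (g h : Hecke ℓ) : hOp n ρ (g * h) = hOp n ρ g * hOp n ρ h := by
  refine LinearMap.ext fun f => funext fun w => ?_
  simp [hOp_apply]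

lemma hOp_one : hOp n ρ (1 : Hecke ℓ) = 1 := by
  refine LinearMap.ext fun f => funext fun w => ?_
  simp [hOp_apply]

lemma hOp_add (g h : Hecke ℓ) : hOp n ρ (g + h) = hOp n ρ g + hOp n ρ h := by
  refine LinearMap.ext fun f => funext fun w => ?_
  simp [hOp_apply]

lemma hOp_smul (c : ℂ) (h : Hecke ℓ) : hOp n ρ (c • h) = c • hOp n ρ h := by
  refine LinearMap.ext fun f => funext fun w => ?_
  simp [hOp_apply]

lemma hOp_mul_tauOp (h : Hecke ℓ) (m : Fin ℓ) (a b : Fin n) :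
    hOp n ρ h * tauOp m a b = tauOp m a b * hOp n ρ h := by
  refine LinearMap.ext fun f => funext fun w => ?_
  simp only [Module.End.mul_apply, hOp_apply, tauOp_apply, apply_ite (ρ h), map_zero]

lemma hOp_mul_permOp (h : Hecke ℓ) (σ : Equiv.Perm (Fin ℓ)) :
    hOp n ρ h * permOp n σ = permOp n σ * hOp n ρ h := rfl

lemma hOp_mul_unitOp (h : Hecke ℓ) (I : Finset (Fin ℓ)) (u v : Word ℓ n) :
    hOp n ρ h * unitOp I u v = unitOp I u v * hOp n ρ h := by
  refine LinearMap.ext fun f => funext fun w => ?_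
  simp only [Module.End.mul_apply, hOp_apply, unitOp_apply, apply_ite (ρ h), map_zero]

lemma hOp_mul_of_mem_matrixOps (h : Hecke ℓ) {X : Module.End ℂ (MW ℓ n M)}
    (hX : X ∈ matrixOps ℓ n M) : hOp n ρ h * X = X * hOp n ρ h := by
  refine Submodule.span_induction ?_ ?_ ?_ ?_ hX
  · rintro _ ⟨⟨u, v⟩, rfl⟩
    exact hOp_mul_unitOp ρ h _ u v
  · simp
  · intro a b _ _ ha hb
    rw [mul_add, add_mul, ha, hb]
  · intro c a _ ha
    rw [mul_smul_comm, smul_mul_assoc, ha]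

/-- The diagonal action `K_σ P_σ` of `σ ∈ W_ℓ` on `M ⊗ (ℂ^n)^{⊗ℓ}`. -/
def diagOp (n : ℕ) {ℓ : ℕ} {M : Type} [AddCommGroup M] [Module ℂ M]
    (ρ : Hecke ℓ →ₐ[ℂ] Module.End ℂ M) (σ : Equiv.Perm (Fin ℓ)) : Module.End ℂ (MW ℓ n M) :=
  hOp n ρ (Hecke.sigma σ) * permOp n σ

lemma diagOp_one : diagOp n ρ 1 = 1 := by
  rw [diagOp, Hecke.sigma_one, hOp_one, permOp_one, one_mul]

lemma diagOp_mul (σ τ : Equiv.Perm (Fin ℓ)) :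
    diagOp n ρ (σ * τ) = diagOp n ρ σ * diagOp n ρ τ := by
  rw [diagOp, diagOp, diagOp, Hecke.sigma_mul, hOp_mul, ← permOp_mul_permOp]
  rw [mul_assoc, mul_assoc, ← mul_assoc (permOp n σ), ← hOp_mul_permOp]
  simp only [mul_assoc]

lemma diagOp_mul_hOp_yProd (σ : Equiv.Perm (Fin ℓ)) (l : List (Fin ℓ)) :
    diagOp n ρ σ * hOp n ρ (Hecke.yProd l) =
      hOp n ρ (Hecke.yProd (l.map σ)) * diagOp n ρ σ := by
  rw [diagOp, mul_assoc, ← hOp_mul_permOp, ← mul_assoc, ← hOp_mul, Hecke.sigma_mul_yProd, hOp_mul,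
    mul_assoc]

lemma diagOp_mul_hOp_y_pow (σ : Equiv.Perm (Fin ℓ)) (m : Fin ℓ) (d : ℕ) :
    diagOp n ρ σ * hOp n ρ (Hecke.y m ^ d) = hOp n ρ (Hecke.y (σ m) ^ d) * diagOp n ρ σ := by
  simpa [Hecke.yProd] using diagOp_mul_hOp_yProd (n := n) ρ σ (List.replicate d m)

lemma diagOp_mul_tauOp (σ : Equiv.Perm (Fin ℓ)) (m : Fin ℓ) (a b : Fin n) :
    diagOp n ρ σ * tauOp m a b = tauOp (σ m) a b * diagOp n ρ σ := by
  rw [diagOp, mul_assoc, permOp_mul_tauOp, ← mul_assoc, hOp_mul_tauOp, mul_assoc]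

lemma diagOp_mul_unitOp {σ : Equiv.Perm (Fin ℓ)} {I : Finset (Fin ℓ)} (hσ : ∀ m ∈ I, σ m = m)
    (u v : Word ℓ n) : diagOp n ρ σ * unitOp I u v = unitOp I u v * diagOp n ρ σ := by
  rw [diagOp, mul_assoc, permOp_mul_unitOp hσ, ← mul_assoc, hOp_mul_unitOp, mul_assoc]

lemma sumOp_eq (a b : Fin n) (d : ℕ) :
    sumOp n ρ a b d = ∑ m, hOp n ρ (Hecke.y m ^ d) * tauOp m a b := rfl

lemma diagOp_mul_sumOp (σ : Equiv.Perm (Fin ℓ)) (a b : Fin n) (d : ℕ) :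
    diagOp n ρ σ * sumOp n ρ a b d = sumOp n ρ a b d * diagOp n ρ σ := by
  rw [sumOp_eq, Finset.mul_sum, Finset.sum_mul, ← Equiv.sum_comp σ (fun m => _ * diagOp n ρ σ)]
  refine Finset.sum_congr rfl fun m _ => ?_
  rw [← mul_assoc, diagOp_mul_hOp_y_pow, mul_assoc, diagOp_mul_tauOp, mul_assoc]

/-- The antisymmetrizer `Σ_σ sgn(σ) σ` on `M ⊗ (ℂ^n)^{⊗ℓ}`. -/
def antisymmetrizer (n : ℕ) {ℓ : ℕ} {M : Type} [AddCommGroup M] [Module ℂ M]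
    (ρ : Hecke ℓ →ₐ[ℂ] Module.End ℂ M) : Module.End ℂ (MW ℓ n M) :=
  ∑ σ : Equiv.Perm (Fin ℓ), (Equiv.Perm.sign σ : ℤ) • diagOp n ρ σ

lemma antisymmetrizer_mul_diagOp (τ : Equiv.Perm (Fin ℓ)) :
    antisymmetrizer n ρ * diagOp n ρ τ = (Equiv.Perm.sign τ : ℤ) • antisymmetrizer n ρ := by
  rw [antisymmetrizer, Finset.sum_mul, Finset.smul_sum,
    ← Equiv.sum_comp (Equiv.mulRight τ) (fun σ => (Equiv.Perm.sign τ : ℤ) • _)]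
  refine Finset.sum_congr rfl fun σ _ => ?_
  rw [Equiv.coe_mulRight, smul_mul_assoc, diagOp_mul, smul_smul, map_mul, Units.val_mul,
    mul_left_comm, ← Units.val_mul, Int.units_mul_self, Units.val_one, mul_one]

lemma diagOp_mul_antisymmetrizer (τ : Equiv.Perm (Fin ℓ)) :
    diagOp n ρ τ * antisymmetrizer n ρ = (Equiv.Perm.sign τ : ℤ) • antisymmetrizer n ρ := by
  rw [antisymmetrizer, Finset.mul_sum, Finset.smul_sum,
    ← Equiv.sum_comp (Equiv.mulLeft τ) (fun σ => (Equiv.Perm.sign τ : ℤ) • _)]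
  refine Finset.sum_congr rfl fun σ _ => ?_
  rw [Equiv.coe_mulLeft, mul_smul_comm, diagOp_mul, smul_smul, map_mul, Units.val_mul,
    ← mul_assoc, ← Units.val_mul, Int.units_mul_self, Units.val_one, one_mul]

lemma antisymmetrizer_mul_sumOp (a b : Fin n) (d : ℕ) :
    antisymmetrizer n ρ * sumOp n ρ a b d = sumOp n ρ a b d * antisymmetrizer n ρ := by
  rw [antisymmetrizer, Finset.sum_mul, Finset.mul_sum]
  refine Finset.sum_congr rfl fun σ _ => ?_
  rw [smul_mul_assoc, mul_smul_comm, diagOp_mul_sumOp]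

lemma diagOp_swap_add_mem_NSub (i : Fin ℓ) (h : (i : ℕ) + 1 < ℓ) (f : MW ℓ n M) :
    diagOp n ρ (Equiv.swap i ⟨i + 1, h⟩) f + f ∈ NSub n ρ :=
  Submodule.mem_iSup_of_mem i (Submodule.mem_iSup_of_mem h ⟨f, rfl⟩)

lemma diagOp_sub_sign_smul_mem_NSub (σ : Equiv.Perm (Fin ℓ)) (f : MW ℓ n M) :
    diagOp n ρ σ f - (Equiv.Perm.sign σ : ℤ) • f ∈ NSub n ρ := by
  induction σ using Equiv.Perm.simple_transposition_induction with
  | one => simp [diagOp_one]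
  | swap_mul i h w ih =>
    have hne : i ≠ ⟨i + 1, h⟩ := by simp [Fin.ext_iff]
    have := sub_mem (diagOp_swap_add_mem_NSub ρ i h (diagOp n ρ w f)) ih
    convert this using 1
    rw [diagOp_mul, Module.End.mul_apply, map_mul, Equiv.Perm.sign_swap hne]
    simp only [neg_mul, one_mul, Units.val_neg, neg_smul]
    abel

lemma antisymmetrizer_sub_factorial_smul_mem_NSub (f : MW ℓ n M) :
    antisymmetrizer n ρ f - (ℓ.factorial : ℂ) • f ∈ NSub n ρ := by
  have h : antisymmetrizer n ρ f - (ℓ.factorial : ℂ) • f = ∑ σ : Equiv.Perm (Fin ℓ),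
      (Equiv.Perm.sign σ : ℤ) • (diagOp n ρ σ f - (Equiv.Perm.sign σ : ℤ) • f) := by
    simp only [smul_sub, smul_smul, ← Units.val_mul, Int.units_mul_self, Units.val_one, one_smul,
      Finset.sum_sub_distrib, Finset.sum_const, Finset.card_univ, Fintype.card_perm,
      Fintype.card_fin, antisymmetrizer, LinearMap.sum_apply, LinearMap.smul_apply,
      Nat.cast_smul_eq_nsmul]
  rw [h]
  exact sum_mem fun σ _ => zsmul_mem (diagOp_sub_sign_smul_mem_NSub ρ σ f) _

end DrinfeldModule

section Irreducibility

variable {ℓ n : ℕ} {M : Type} [AddCommGroup M] [Module ℂ M]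
  {ρ : Hecke ℓ →ₐ[ℂ] Module.End ℂ M}

/-- The operators whose compression by the antisymmetrizer preserves the subspace `q`. -/
def compressionStabilizer (n : ℕ) {ℓ : ℕ} {M : Type} [AddCommGroup M] [Module ℂ M]
    (ρ : Hecke ℓ →ₐ[ℂ] Module.End ℂ M) (q : Submodule ℂ (MW ℓ n M)) :
    Submodule ℂ (Module.End ℂ (MW ℓ n M)) where
  carrier := {A | ∀ x ∈ q, antisymmetrizer n ρ (A (antisymmetrizer n ρ x)) ∈ q}
  zero_mem' x _ := by simp
  add_mem' {A B} hA hB x hx := by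
    rw [LinearMap.add_apply, map_add]
    exact add_mem (hA x hx) (hB x hx)
  smul_mem' c A hA x hx := by
    rw [LinearMap.smul_apply, map_smul]
    exact Submodule.smul_mem _ _ (hA x hx)

lemma mem_compressionStabilizer {q : Submodule ℂ (MW ℓ n M)} {A : Module.End ℂ (MW ℓ n M)} :
    A ∈ compressionStabilizer n ρ q ↔
      ∀ x ∈ q, (antisymmetrizer n ρ * A * antisymmetrizer n ρ) x ∈ q := Iff.rfl

lemma sign_smul_mem_iff {V : Type*} [AddCommGroup V] [Module ℂ V] (q : Submodule ℂ V)
    (σ : Equiv.Perm (Fin ℓ)) (x : V) : (Equiv.Perm.sign σ : ℤ) • x ∈ q ↔ x ∈ q := by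
  rcases Int.units_eq_one_or (Equiv.Perm.sign σ) with h | h <;> simp [h]

lemma mul_diagOp_mem_compressionStabilizer_iff {q : Submodule ℂ (MW ℓ n M)}
    (σ : Equiv.Perm (Fin ℓ)) (A : Module.End ℂ (MW ℓ n M)) :
    A * diagOp n ρ σ ∈ compressionStabilizer n ρ q ↔ A ∈ compressionStabilizer n ρ q := by
  simp only [mem_compressionStabilizer, mul_assoc, diagOp_mul_antisymmetrizer, mul_smul_comm,
    LinearMap.smul_apply, sign_smul_mem_iff]

lemma sub_mem_compressionStabilizer_of_conj {q : Submodule ℂ (MW ℓ n M)}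
    {σ : Equiv.Perm (Fin ℓ)} {A B : Module.End ℂ (MW ℓ n M)}
    (h : diagOp n ρ σ * A = B * diagOp n ρ σ) : A - B ∈ compressionStabilizer n ρ q := by
  have h1 : antisymmetrizer n ρ * A = (Equiv.Perm.sign σ : ℤ) •
      (antisymmetrizer n ρ * (diagOp n ρ σ * A)) := by
    rw [← mul_assoc, antisymmetrizer_mul_diagOp, smul_mul_assoc, smul_smul, ← Units.val_mul,
      Int.units_mul_self, Units.val_one, one_smul]
  have h2 : antisymmetrizer n ρ * (A - B) * antisymmetrizer n ρ = 0 := by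
    rw [mul_sub, h1, h, sub_mul, smul_mul_assoc, mul_assoc _ _ (antisymmetrizer n ρ),
      mul_assoc B, diagOp_mul_antisymmetrizer, mul_smul_comm, mul_smul_comm, smul_smul,
      ← Units.val_mul, Int.units_mul_self, Units.val_one, one_smul, ← mul_assoc, sub_self]
  intro x _
  change (antisymmetrizer n ρ * (A - B) * antisymmetrizer n ρ) x ∈ q
  simp [h2]

lemma antisymmetrizer_mem {q : Submodule ℂ (MW ℓ n M)} (hq : NSub n ρ ≤ q) {x : MW ℓ n M}
    (hx : x ∈ q) : antisymmetrizer n ρ x ∈ q := by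
  have := add_mem (hq (antisymmetrizer_sub_factorial_smul_mem_NSub ρ x))
    (q.smul_mem (ℓ.factorial : ℂ) hx)
  rwa [sub_add_cancel] at this

lemma mem_of_antisymmetrizer_mem {q : Submodule ℂ (MW ℓ n M)} (hq : NSub n ρ ≤ q)
    {x : MW ℓ n M} (hx : antisymmetrizer n ρ x ∈ q) : x ∈ q := by
  have := sub_mem hx (hq (antisymmetrizer_sub_factorial_smul_mem_NSub ρ x))
  rw [sub_sub_cancel] at this
  exact (q.smul_mem_iff (Nat.cast_ne_zero.2 ℓ.factorial_ne_zero)).1 this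

lemma one_mem_compressionStabilizer {q : Submodule ℂ (MW ℓ n M)} (hq : NSub n ρ ≤ q) :
    1 ∈ compressionStabilizer n ρ q := fun _ hx =>
  antisymmetrizer_mem hq (antisymmetrizer_mem hq hx)

lemma sumOp_mul_mem_compressionStabilizer {q : Submodule ℂ (MW ℓ n M)}
    (hs : ∀ a b d, ∀ x ∈ q, sumOp n ρ a b d x ∈ q) {A : Module.End ℂ (MW ℓ n M)}
    (hA : A ∈ compressionStabilizer n ρ q) (a b : Fin n) (d : ℕ) :
    sumOp n ρ a b d * A ∈ compressionStabilizer n ρ q := by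
  rw [mem_compressionStabilizer] at hA ⊢
  intro x hx
  rw [← mul_assoc, antisymmetrizer_mul_sumOp, mul_assoc, mul_assoc, ← mul_assoc _ A]
  exact hs a b d _ (hA x hx)

/-- The elements `h` such that `h ⊗ X` lies in the compression stabilizer of `q` for every
endomorphism `X` of `(ℂ^n)^{⊗ℓ}`. -/
def heckeStabilizer (n : ℕ) {ℓ : ℕ} {M : Type} [AddCommGroup M] [Module ℂ M]
    (ρ : Hecke ℓ →ₐ[ℂ] Module.End ℂ M) (q : Submodule ℂ (MW ℓ n M)) :
    Submodule ℂ (Hecke ℓ) where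
  carrier := {h | ∀ X ∈ matrixOps ℓ n M, hOp n ρ h * X ∈ compressionStabilizer n ρ q}
  zero_mem' X _ := by
    have : hOp n ρ (0 : Hecke ℓ) = 0 := by simpa using hOp_smul (n := n) ρ 0 0
    simp [this]
  add_mem' {g h} hg hh X hX := by
    rw [hOp_add, add_mul]
    exact add_mem (hg X hX) (hh X hX)
  smul_mem' c h hh X hX := by
    rw [hOp_smul, smul_mul_assoc]
    exact Submodule.smul_mem _ _ (hh X hX)

lemma mul_sigma_mem_heckeStabilizer {q : Submodule ℂ (MW ℓ n M)} {h : Hecke ℓ}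
    (hh : h ∈ heckeStabilizer n ρ q) (w : Equiv.Perm (Fin ℓ)) :
    h * Hecke.sigma w ∈ heckeStabilizer n ρ q := by
  intro X hX
  have key : hOp n ρ (h * Hecke.sigma w) * X =
      hOp n ρ h * (X * permOp n w⁻¹) * diagOp n ρ w := by
    have : permOp n w⁻¹ * diagOp n ρ w = hOp n ρ (Hecke.sigma w) := by
      rw [diagOp, hOp_mul_permOp, ← mul_assoc, permOp_mul_permOp, inv_mul_cancel, permOp_one,
        one_mul]
    rw [mul_assoc, mul_assoc X, this, hOp_mul, mul_assoc, hOp_mul_of_mem_matrixOps ρ _ hX]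
  rw [key, mul_diagOp_mem_compressionStabilizer_iff]
  exact hh _ (mul_permOp_mem_matrixOps _ hX)

/-- One tensor slot at a time: if `yProd l` times a matrix unit on the slots `I` lies in the
compression stabilizer, then one more slot `m₀ ∉ I` can be filled, provided that the terms where
the new factor lands in `I` are in the stabilizer. -/
lemma fill_slot_mem_compressionStabilizer {q : Submodule ℂ (MW ℓ n M)}
    (hs : ∀ a b d, ∀ x ∈ q, sumOp n ρ a b d x ∈ q) {I : Finset (Fin ℓ)} {l : List (Fin ℓ)}
    (hl : ∀ m ∈ l, m ∈ I) {u v : Word ℓ n}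
    (hA : hOp n ρ (Hecke.yProd l) * unitOp I u v ∈ compressionStabilizer n ρ q)
    (a b : Fin n) (d : ℕ)
    (hI : ∀ m ∈ I, hOp n ρ (Hecke.y m ^ d) * tauOp m a b *
      (hOp n ρ (Hecke.yProd l) * unitOp I u v) ∈ compressionStabilizer n ρ q)
    {m₀ : Fin ℓ} (hm₀ : m₀ ∉ I) :
    hOp n ρ (Hecke.y m₀ ^ d) * tauOp m₀ a b *
      (hOp n ρ (Hecke.yProd l) * unitOp I u v) ∈ compressionStabilizer n ρ q := by
  obtain ⟨A, hA'⟩ : ∃ A : Module.End ℂ (MW ℓ n M),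
    A = hOp n ρ (Hecke.yProd l) * unitOp I u v := ⟨_, rfl⟩
  rw [← hA'] at hA hI ⊢
  set g : Fin ℓ → Module.End ℂ (MW ℓ n M) :=
    fun m => hOp n ρ (Hecke.y m ^ d) * tauOp m a b * A with hg
  have hsum : ∑ m, g m ∈ compressionStabilizer n ρ q := by
    rw [← Finset.sum_mul, ← sumOp_eq]
    exact sumOp_mul_mem_compressionStabilizer hs hA a b d
  have hout : ∑ m ∈ Iᶜ, g m ∈ compressionStabilizer n ρ q := by
    rw [← Finset.sum_add_sum_compl I] at hsum
    rw [← add_sub_cancel_left (∑ m ∈ I, g m) (∑ m ∈ Iᶜ, g m)]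
    exact sub_mem hsum (sum_mem (t := I) hI)
  have hconj : ∀ m ∈ Iᶜ, g m₀ - g m ∈ compressionStabilizer n ρ q := by
    intro m hm
    rw [Finset.mem_compl] at hm
    have hfix : ∀ k ∈ I, Equiv.swap m₀ m k = k := fun k hk =>
      Equiv.swap_apply_of_ne_of_ne (ne_of_mem_of_not_mem hk hm₀) (ne_of_mem_of_not_mem hk hm)
    refine sub_mem_compressionStabilizer_of_conj (σ := Equiv.swap m₀ m) ?_
    have hmap : l.map (Equiv.swap m₀ m) = l := by
      conv_rhs => rw [← List.map_id l]
      exact List.map_congr_left fun k hk => hfix k (hl k hk)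
    have hcomm : diagOp n ρ (Equiv.swap m₀ m) * A = A * diagOp n ρ (Equiv.swap m₀ m) := by
      rw [hA', ← mul_assoc, diagOp_mul_hOp_yProd, hmap, mul_assoc, diagOp_mul_unitOp ρ hfix,
        mul_assoc]
    rw [hg]
    simp only
    rw [← mul_assoc, ← mul_assoc, diagOp_mul_hOp_y_pow, mul_assoc _ (diagOp _ _ _),
      diagOp_mul_tauOp, Equiv.swap_apply_left, mul_assoc, mul_assoc, hcomm]
    simp only [mul_assoc]
  have hcard : ((Iᶜ.card : ℕ) : ℂ) • g m₀ ∈ compressionStabilizer n ρ q := by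
    have := add_mem (sum_mem hconj) hout
    rwa [← Finset.sum_add_distrib, Finset.sum_congr rfl fun m _ => sub_add_cancel _ _,
      Finset.sum_const, ← Nat.cast_smul_eq_nsmul ℂ] at this
  refine (Submodule.smul_mem_iff _ (Nat.cast_ne_zero.2 ?_)).1 hcard
  exact Finset.card_ne_zero_of_mem (Finset.mem_compl.2 hm₀)

lemma yProd_mul_unitOp_mem_compressionStabilizer {q : Submodule ℂ (MW ℓ n M)}
    (hq : NSub n ρ ≤ q) (hs : ∀ a b d, ∀ x ∈ q, sumOp n ρ a b d x ∈ q) {N : ℕ}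
    (hN : Hecke.filtration ℓ N ≤ heckeStabilizer n ρ q) (I : Finset (Fin ℓ)) (u v : Word ℓ n)
    (l : List (Fin ℓ)) (hlN : l.length ≤ N) (hl : ∀ m ∈ l, m ∈ I) :
    hOp n ρ (Hecke.yProd l) * unitOp I u v ∈ compressionStabilizer n ρ q := by
  induction I using Finset.induction_on generalizing u v l with
  | empty =>
    obtain rfl : l = [] := List.eq_nil_iff_forall_not_mem.2 fun m hm => by simpa using hl m hm
    rw [Hecke.yProd_nil, hOp_one, unitOp_empty, mul_one]
    exact one_mem_compressionStabilizer hq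
  | insert m₀ I hm₀ ih =>
    set d := l.count m₀ with hd
    set l₀ := l.filter (fun m => ¬ m = m₀) with hl₀
    have hperm : l.Perm (List.replicate d m₀ ++ l₀) := by
      have := List.filter_append_perm (fun m => decide (m = m₀)) l
      rw [List.filter_eq] at this
      simpa [hd, hl₀] using this.symm
    have hlen : d + l₀.length = l.length := by simp [hperm.length_eq]
    have hl₀I : ∀ m ∈ l₀, m ∈ I := fun m hm => by
      rw [hl₀, List.mem_filter] at hm
      have := hl m hm.1
      simp_all
    have hlow := hN (Hecke.filtration_mono hlN (Hecke.yProd_sub_yProd_mem_filtration hperm))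
      _ (unitOp_mem_matrixOps (insert m₀ I) u v)
    have hmove (m : Fin ℓ) (a b : Fin n) :
        hOp n ρ (Hecke.y m ^ d) * tauOp m a b * (hOp n ρ (Hecke.yProd l₀) * unitOp I u v) =
        hOp n ρ (Hecke.yProd (List.replicate d m ++ l₀)) * (tauOp m a b * unitOp I u v) := by
      rw [Hecke.yProd_replicate_append, hOp_mul, mul_assoc, ← mul_assoc (tauOp m a b),
        ← hOp_mul_tauOp]
      simp only [mul_assoc]
    have hmain := fill_slot_mem_compressionStabilizer hs hl₀I
      (ih u v l₀ (by omega) hl₀I) (u m₀) (v m₀) d (fun m hm => ?_) hm₀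
    · rw [hmove, tauOp_mul_unitOp_of_notMem hm₀] at hmain
      have := add_mem hlow hmain
      rwa [← add_mul, ← hOp_add, sub_add_cancel] at this
    · rw [hmove, tauOp_mul_unitOp_of_mem hm]
      split_ifs
      · refine ih _ _ _ (by simp; omega) fun k hk => ?_
        rcases List.mem_append.1 hk with hk | hk
        · rwa [List.eq_of_mem_replicate hk]
        · exact hl₀I k hk
      · simp

lemma heckeStabilizer_eq_top {q : Submodule ℂ (MW ℓ n M)}
    (hq : NSub n ρ ≤ q) (hs : ∀ a b d, ∀ x ∈ q, sumOp n ρ a b d x ∈ q) :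
    heckeStabilizer n ρ q = ⊤ := by
  have H (N : ℕ) : Hecke.filtration ℓ N ≤ heckeStabilizer n ρ q := by
    induction N with
    | zero =>
      refine Submodule.span_le.2 ?_
      rintro _ ⟨l, w, hl, _⟩
      simp at hl
    | succ N ih =>
      refine Submodule.span_le.2 ?_
      rintro _ ⟨l, w, hl, rfl⟩
      refine mul_sigma_mem_heckeStabilizer (fun X hX => ?_) w
      refine Submodule.span_induction ?_ ?_ ?_ ?_ hX
      · rintro _ ⟨⟨u, v⟩, rfl⟩
        exact yProd_mul_unitOp_mem_compressionStabilizer hq hs ih _ u v l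
          (Nat.lt_succ_iff.1 hl) (by simp)
      · simp
      · intro a b _ _ ha hb
        rw [mul_add]
        exact add_mem ha hb
      · intro c a _ ha
        rw [mul_smul_comm]
        exact Submodule.smul_mem _ _ ha
  refine eq_top_iff.2 fun h _ => ?_
  obtain ⟨N, hN⟩ := Hecke.exists_mem_filtration h
  exact H N hN

lemma HSimple.exists_apply_eq (hM : HSimple ρ) {x : M} (hx : x ≠ 0) (z : M) :
    ∃ h : Hecke ℓ, ρ h x = z := by
  let p : Submodule ℂ M := LinearMap.range ((LinearMap.applyₗ x).comp ρ.toLinearMap)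
  have hp : HStable ρ p := by
    rintro h _ ⟨g, rfl⟩
    exact ⟨h * g, by simp⟩
  rcases hM.2 p hp with h | h
  · have : x ∈ p := ⟨1, by simp⟩
    rw [h, Submodule.mem_bot] at this
    exact absurd this hx
  · have : z ∈ p := h ▸ Submodule.mem_top
    simpa [p] using this

lemma HSimple.eq_top_of_not_le_NSub (hM : HSimple ρ) {q : Submodule ℂ (MW ℓ n M)}
    (hq : NSub n ρ ≤ q) (hs : ∀ a b d, ∀ x ∈ q, sumOp n ρ a b d x ∈ q)
    (hne : ¬ q ≤ NSub n ρ) : q = ⊤ := by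
  obtain ⟨x, hxq, hxN⟩ := SetLike.not_le_iff_exists.1 hne
  have hx : antisymmetrizer n ρ x ≠ 0 := fun h =>
    hxN (mem_of_antisymmetrizer_mem le_rfl (h ▸ zero_mem _))
  obtain ⟨v, hv⟩ := Function.ne_iff.1 hx
  refine eq_top_iff.2 fun f _ => ?_
  rw [← Finset.univ_sum_single f]
  refine sum_mem fun u _ => mem_of_antisymmetrizer_mem hq ?_
  obtain ⟨h, hh⟩ := hM.exists_apply_eq hv (f u)
  have hmem : h ∈ heckeStabilizer n ρ q := heckeStabilizer_eq_top hq hs ▸ Submodule.mem_top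
  have := hmem _ (unitOp_univ_mem_matrixOps u v) x hxq
  convert this using 2
  funext w
  rw [Module.End.mul_apply, hOp_apply, unitOp_univ_apply]
  rcases eq_or_ne w u with rfl | hwu
  · simp [hh]
  · simp [hwu]

end Irreducibility

/-- Let `M` be a finite-dimensional simple `H_ℓ`-module. Then the
`Y(gl_n)`-module `D_ℓ(M)` is either zero or a simple `Y(gl_n)`-module. -/
theorem statement2 (n ℓ : ℕ) (hn : 0 < n) (hℓ : 0 < ℓ)
    (M : Type) [AddCommGroup M] [Module ℂ M] [FiniteDimensional ℂ M]
    (ρ : Hecke ℓ →ₐ[ℂ] Module.End ℂ M) (hM : HSimple ρ)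
    (π : Yangian n →ₐ[ℂ] Module.End ℂ (Dmod n ρ))
    (hπ : IsDrinfeldAction n ρ π) :
    Subsingleton (Dmod n ρ) ∨ YSimple π := by
  rcases subsingleton_or_nontrivial (Dmod n ρ) with h | h
  · exact Or.inl h
  refine Or.inr ⟨h, fun q hq => ?_⟩
  have hs : ∀ a b d, ∀ x ∈ q.comap (NSub n ρ).mkQ, sumOp n ρ a b d x ∈ q.comap (NSub n ρ).mkQ := by
    intro a b d x hx
    have := hq (Yangian.t a b d) _ hx
    rwa [Submodule.mkQ_apply, hπ] at this
  have hN : NSub n ρ ≤ q.comap (NSub n ρ).mkQ := Submodule.le_comap_mkQ _ q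
  by_cases hle : q.comap (NSub n ρ).mkQ ≤ NSub n ρ
  · left
    rw [← Submodule.map_comap_eq_of_surjective (NSub n ρ).mkQ_surjective q, eq_bot_iff,
      Submodule.map_le_iff_le_comap]
    simpa using hle
  · right
    rw [← Submodule.map_comap_eq_of_surjective (NSub n ρ).mkQ_surjective q,
      hM.eq_top_of_not_le_NSub hN hs hle]
    simp
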